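/- In the adversarial setup, suppose P is φ-irreducible with π(K_D) > 0 and π(K_{2D} ∖ K_D) > 0, and suppose assumption (A3) holds with minorizing measure ν* equal to the probability measure μ* concentrated on K_{2D} ∖ K_D appearing in (A1). Then assumption (A2) holds: the expected time for a Markov chain with transitions P started from the distribution μ* to reach the set K_D is finite. -/

import Mathlib

open MeasureTheory ProbabilityTheory Filter Metric Set
open scoped ENNReal Topology

noncomputable def iterK {X : Type*} [MeasurableSpace X] (P : Kernel X X) : ℕ → Kernel X X
  | 0 => Kernel.deterministic id measurable_id
  | n + 1 => P.comp (iterK P n)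

noncomputable def tvDist {X : Type*} [MeasurableSpace X] (μ ν : Measure X) : ℝ≥0∞ :=
  ⨆ A : {s : Set X // MeasurableSet s}, (μ A.1 - ν A.1) ⊔ (ν A.1 - μ A.1)

def HarrisErgodic {X : Type*} [MeasurableSpace X] (P : Kernel X X) (π : Measure X) : Prop :=
  (∀ A : Set X, MeasurableSet A → ∫⁻ x, P x A ∂π = π A) ∧
    ∀ x, Tendsto (fun n => tvDist (iterK P n x) π) atTop (𝓝 0)

def IsAdversarial {X Ω : Type*} [MeasurableSpace X] [MetricSpace X] [MeasurableSpace Ω]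
    (P : Kernel X X) (K : Set X) (D : ℝ) (x₀ : X) (μ : Measure Ω) (Xp : ℕ → Ω → X) : Prop :=
  (∀ n, Measurable (Xp n)) ∧ (∀ ω, Xp 0 ω = x₀) ∧
  (∀ (n : ℕ) (A : Set X), MeasurableSet A → ∀ E : Set Ω,
      MeasurableSet[MeasurableSpace.comap (fun ω (i : Fin (n + 1)) => Xp i ω) inferInstance] E →
      μ (E ∩ {ω | Xp n ω ∉ K} ∩ {ω | Xp (n + 1) ω ∈ A}) =
        ∫⁻ ω in E ∩ {ω | Xp n ω ∉ K}, P (Xp n ω) A ∂μ) ∧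
  (∀ n : ℕ, μ ({ω | Xp n ω ∈ K} ∩ {ω | Xp (n + 1) ω ∉ cthickening D K}) = 0)

def BoundedInProb {X Ω : Type*} [MeasurableSpace Ω] [MetricSpace X]
    (μ : Measure Ω) (Xp : ℕ → Ω → X) (o : X) : Prop :=
  Tendsto (fun L : ℝ => ⨆ n, μ {ω | L < dist (Xp n ω) o}) atTop (𝓝 0)

def IsMarkovReal {X Ω : Type*} [MeasurableSpace X] [MeasurableSpace Ω]
    (P : Kernel X X) (ν : Measure X) (μ : Measure Ω) (Y : ℕ → Ω → X) : Prop :=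
  (∀ n, Measurable (Y n)) ∧ μ.map (Y 0) = ν ∧
  (∀ (n : ℕ) (A : Set X), MeasurableSet A → ∀ E : Set Ω,
      MeasurableSet[MeasurableSpace.comap (fun ω (i : Fin (n + 1)) => Y i ω) inferInstance] E →
      μ (E ∩ {ω | Y (n + 1) ω ∈ A}) = ∫⁻ ω in E, P (Y n ω) A ∂μ)

noncomputable def hitTime {X Ω : Type*} (Y : ℕ → Ω → X) (B : Set X) (ω : Ω) : ℝ≥0∞ :=
  ⨅ (n : ℕ) (_ : 1 ≤ n ∧ Y n ω ∈ B), (n : ℝ≥0∞)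

noncomputable def survMeas {X : Type*} [MeasurableSpace X] (P : Kernel X X) (B : Set X)
    (ν : Measure X) : ℕ → Measure X
  | 0 => ν
  | n + 1 => (((survMeas P B ν n).bind (fun x => P x)).restrict Bᶜ)

noncomputable def expKappaHit {X : Type*} [MeasurableSpace X] (P : Kernel X X) (C : Set X)
    (κ : ℝ≥0∞) (x : X) : ℝ≥0∞ :=
  (∑' n : ℕ, κ ^ (n + 1) * ((survMeas P C (Measure.dirac x) n).bind (fun z => P z)) C)
    + ⊤ * (1 - ∑' n : ℕ, ((survMeas P C (Measure.dirac x) n).bind (fun z => P z)) C)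

def IsSmallSet {X : Type*} [MeasurableSpace X] (P : Kernel X X) (C : Set X) : Prop :=
  ∃ ν : Measure X, IsProbabilityMeasure ν ∧ ∃ ε : ℝ≥0∞, 0 < ε ∧ ∃ n₀ : ℕ, 1 ≤ n₀ ∧
    ∀ x ∈ C, ∀ A : Set X, MeasurableSet A → ε * ν A ≤ iterK P n₀ x A

def GeomErgodic {X : Type*} [MeasurableSpace X] (P : Kernel X X) (π : Measure X) : Prop :=
  ∃ ρ : ℝ≥0∞, ρ < 1 ∧ ∃ ξ : X → ℝ≥0∞, Measurable ξ ∧ (∀ x, 1 ≤ ξ x) ∧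
    (∀ᵐ x ∂π, ξ x < ⊤) ∧ ∀ (n : ℕ) (x : X), tvDist (iterK P n x) π ≤ ξ x * ρ ^ n

section Helpers

variable {X : Type*} [MeasurableSpace X]

/-- The probability that the chain started at `x` avoids `B` at all times `1, …, n`. -/
noncomputable def avoidProb (P : Kernel X X) (B : Set X) : ℕ → X → ℝ≥0∞
  | 0 => fun _ => 1
  | n + 1 => fun x => ∫⁻ y in Bᶜ, avoidProb P B n y ∂P x

/-- The expected return time to `B`, as the sum of its tail probabilities. -/
noncomputable def meanReturn (P : Kernel X X) (B : Set X) (x : X) : ℝ≥0∞ :=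
  ∑' n, avoidProb P B n x

/-- The `n`-fold application of the transition operator of `P` to `f`. -/
noncomputable def transIter (P : Kernel X X) (f : X → ℝ≥0∞) : ℕ → X → ℝ≥0∞
  | 0 => f
  | n + 1 => fun x => ∫⁻ y, transIter P f n y ∂P x

/-- The return-time drift function: finite on an absorbing set, and growing by a factor of at
most `4` in each step. -/
noncomputable def returnDrift (P : Kernel X X) (B : Set X) (x : X) : ℝ≥0∞ :=
  meanReturn P B x + ∑' n, (2⁻¹ : ℝ≥0∞) ^ n * transIter P (B.indicator (meanReturn P B)) n x

variable {P : Kernel X X} {B : Set X} {π : Measure X}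

lemma measurable_avoidProb (hB : MeasurableSet B) (n : ℕ) : Measurable (avoidProb P B n) := by
  induction n with
  | zero => exact measurable_const
  | succ n ih =>
    simp only [avoidProb, ← lintegral_indicator hB.compl]
    exact (ih.indicator hB.compl).lintegral_kernel

lemma measurable_meanReturn (hB : MeasurableSet B) : Measurable (meanReturn P B) :=
  Measurable.tsum fun n => measurable_avoidProb hB n

lemma measurable_transIter {f : X → ℝ≥0∞} (hf : Measurable f) (n : ℕ) :
    Measurable (transIter P f n) := by
  induction n with
  | zero => exact hf
  | succ n ih => exact ih.lintegral_kernel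

lemma measurable_returnDrift (hB : MeasurableSet B) : Measurable (returnDrift P B) :=
  (measurable_meanReturn hB).add <| Measurable.tsum fun n =>
    (measurable_transIter ((measurable_meanReturn hB).indicator hB) n).const_mul _

lemma lintegral_lintegral_of_invariant (hinv : π.bind P = π) {f : X → ℝ≥0∞} (hf : Measurable f) :
    ∫⁻ x, ∫⁻ y, f y ∂P x ∂π = ∫⁻ x, f x ∂π := by
  rw [← Measure.lintegral_bind P.measurable.aemeasurable hf.aemeasurable, hinv]

/-- Kac's inequality. -/
lemma setLIntegral_meanReturn_le_one [IsProbabilityMeasure π] (hinv : π.bind P = π)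
    (hB : MeasurableSet B) : ∫⁻ x in B, meanReturn P B x ∂π ≤ 1 := by
  have hstep (n : ℕ) : ∫⁻ x in B, avoidProb P B (n + 1) x ∂π
      + ∫⁻ x in Bᶜ, avoidProb P B (n + 1) x ∂π = ∫⁻ x in Bᶜ, avoidProb P B n x ∂π := by
    rw [lintegral_add_compl _ hB, ← lintegral_indicator hB.compl,
      ← lintegral_lintegral_of_invariant hinv ((measurable_avoidProb hB n).indicator hB.compl)]
    simp only [avoidProb, lintegral_indicator hB.compl]
  have hsum (N : ℕ) : ∑ n ∈ Finset.range (N + 1), ∫⁻ x in B, avoidProb P B n x ∂π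
      + ∫⁻ x in Bᶜ, avoidProb P B N x ∂π = 1 := by
    induction N with
    | zero =>
      simp only [zero_add, Finset.range_one, Finset.sum_singleton]
      rw [lintegral_add_compl _ hB]
      simp [avoidProb]
    | succ N ih => rw [Finset.sum_range_succ, add_assoc, hstep, ih]
  unfold meanReturn
  rw [lintegral_tsum fun n => (measurable_avoidProb hB n).aemeasurable]
  refine ENNReal.tsum_le_of_sum_range_le fun N => ?_
  calc _ ≤ ∑ n ∈ Finset.range (N + 1), ∫⁻ x in B, avoidProb P B n x ∂π :=
        Finset.sum_le_sum_of_subset (Finset.range_mono N.le_succ)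
    _ ≤ 1 := by rw [← hsum N]; exact le_self_add

lemma meanReturn_eq (hB : MeasurableSet B) (x : X) :
    meanReturn P B x = 1 + ∫⁻ y in Bᶜ, meanReturn P B y ∂P x := by
  unfold meanReturn
  rw [tsum_eq_zero_add' ENNReal.summable,
    lintegral_tsum fun n => (measurable_avoidProb hB n).aemeasurable]
  rfl

lemma tsum_geometric_mul_succ_le (u : ℕ → ℝ≥0∞) :
    ∑' n, (2⁻¹ : ℝ≥0∞) ^ n * u (n + 1) ≤ 2 * ∑' n, (2⁻¹ : ℝ≥0∞) ^ n * u n := by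
  have hmul (n : ℕ) : (2⁻¹ : ℝ≥0∞) ^ n * u (n + 1) = 2 * ((2⁻¹ : ℝ≥0∞) ^ (n + 1) * u (n + 1)) := by
    rw [pow_succ', ← mul_assoc, ← mul_assoc, ENNReal.mul_inv_cancel two_ne_zero (by simp), one_mul]
  rw [tsum_congr hmul, ENNReal.tsum_mul_left]
  exact mul_le_mul_right (ENNReal.tsum_comp_le_tsum_of_injective (add_left_injective 1)
    fun n => (2⁻¹ : ℝ≥0∞) ^ n * u n) 2

lemma lintegral_returnDrift_le (hB : MeasurableSet B) (x : X) :
    ∫⁻ y, returnDrift P B y ∂P x ≤ 4 * returnDrift P B x := by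
  set g := B.indicator (meanReturn P B)
  have hg : Measurable g := (measurable_meanReturn hB).indicator hB
  set S := ∑' n, (2⁻¹ : ℝ≥0∞) ^ n * transIter P g n x
  have hS2 : ∑' n, (2⁻¹ : ℝ≥0∞) ^ n * transIter P g (n + 1) x ≤ 2 * S :=
    tsum_geometric_mul_succ_le fun n => transIter P g n x
  have h1 : transIter P g 1 x ≤ 2 * S :=
    le_trans (by simpa using ENNReal.le_tsum (f := fun n =>
      (2⁻¹ : ℝ≥0∞) ^ n * transIter P g (n + 1) x) 0) hS2
  have hh : ∫⁻ y, meanReturn P B y ∂P x ≤ transIter P g 1 x + meanReturn P B x := by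
    rw [← lintegral_add_compl _ hB, meanReturn_eq hB x]
    simp only [transIter, g, lintegral_indicator hB]
    gcongr
    exact le_add_self
  calc ∫⁻ y, returnDrift P B y ∂P x
      = ∫⁻ y, meanReturn P B y ∂P x + ∑' n, (2⁻¹ : ℝ≥0∞) ^ n * transIter P g (n + 1) x := by
        unfold returnDrift
        rw [lintegral_add_left (measurable_meanReturn hB),
          lintegral_tsum fun n => ((measurable_transIter hg n).const_mul _).aemeasurable]
        congr 1
        exact tsum_congr fun n => lintegral_const_mul _ (measurable_transIter hg n)
    _ ≤ (2 * S + meanReturn P B x) + 2 * S := by gcongr; exact hh.trans (by gcongr)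
    _ = meanReturn P B x + 4 * S := by ring
    _ ≤ 4 * meanReturn P B x + 4 * S := by
        gcongr
        exact le_mul_of_one_le_left zero_le (by norm_num)
    _ = 4 * returnDrift P B x := by rw [← mul_add]; rfl

lemma lintegral_iterK_le {V : X → ℝ≥0∞} (hV : Measurable V) {c : ℝ≥0∞}
    (h : ∀ x, ∫⁻ y, V y ∂P x ≤ c * V x) (n : ℕ) (x : X) :
    ∫⁻ y, V y ∂iterK P n x ≤ c ^ n * V x := by
  induction n with
  | zero => simp [iterK, Kernel.deterministic_apply, lintegral_dirac' _ hV]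
  | succ n ih =>
    rw [iterK, Kernel.lintegral_comp _ _ _ hV]
    calc _ ≤ ∫⁻ y, c * V y ∂iterK P n x := lintegral_mono h
      _ = c * ∫⁻ y, V y ∂iterK P n x := lintegral_const_mul _ hV
      _ ≤ c * (c ^ n * V x) := by gcongr
      _ = c ^ (n + 1) * V x := by rw [pow_succ', mul_assoc]

lemma bind_iterK (hinv : π.bind P = π) (n : ℕ) : π.bind (iterK P n) = π := by
  induction n with
  | zero =>
    rw [iterK, Measure.deterministic_comp_eq_map, Measure.map_id]
  | succ n ih => rw [iterK, ← Measure.comp_assoc, ih, hinv]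

instance isMarkovKernel_iterK [IsMarkovKernel P] (n : ℕ) : IsMarkovKernel (iterK P n) := by
  induction n with
  | zero => rw [iterK]; infer_instance
  | succ n ih => rw [iterK]; infer_instance

/-- For an irreducible kernel, a nonempty absorbing set has full invariant measure. -/
lemma measure_compl_eq_zero_of_absorbing [IsMarkovKernel P] [IsProbabilityMeasure π]
    (hinv : π.bind P = π) {φ : Measure X} (hφ : φ ≠ 0)
    (hirr : ∀ A : Set X, MeasurableSet A → 0 < φ A → ∀ x : X, ∃ n : ℕ, 1 ≤ n ∧ 0 < iterK P n x A)
    {G : Set X} (hG : MeasurableSet G) (hne : G.Nonempty)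
    (habs : ∀ n, ∀ x ∈ G, iterK P n x Gᶜ = 0) : π Gᶜ = 0 := by
  have hφc : φ Gᶜ = 0 := by
    by_contra h
    obtain ⟨x, hx⟩ := hne
    obtain ⟨n, -, hn⟩ := hirr _ hG.compl (pos_iff_ne_zero.2 h) x
    exact hn.ne' (habs n x hx)
  have hφG : 0 < φ G := by
    refine pos_iff_ne_zero.2 fun h => hφ (Measure.measure_univ_eq_zero.1 ?_)
    rw [← measure_add_measure_compl hG, h, hφc, add_zero]
  have hzero (n : ℕ) : ∀ᵐ x ∂π.restrict Gᶜ, iterK P n x G = 0 := by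
    have htot : ∫⁻ x, iterK P n x G ∂π = π G := by
      rw [← Measure.bind_apply hG (iterK P n).measurable.aemeasurable, bind_iterK hinv]
    have hin : ∫⁻ x in G, iterK P n x G ∂π = π G := by
      rw [setLIntegral_congr_fun hG (g := fun _ => 1)
        fun x hx => (prob_compl_eq_zero_iff hG).1 (habs n x hx)]
      simp
    rw [← lintegral_add_compl _ hG, hin] at htot
    have : ∫⁻ x in Gᶜ, iterK P n x G ∂π = 0 :=
      (ENNReal.add_right_inj (measure_ne_top π G)).1 (htot.trans (add_zero _).symm)
    exact (lintegral_eq_zero_iff ((iterK P n).measurable_coe hG)).1 this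
  have hfalse : ∀ᵐ _ ∂π.restrict Gᶜ, False := by
    filter_upwards [ae_all_iff.2 hzero] with x hx
    obtain ⟨n, -, hn⟩ := hirr G hG hφG x
    exact hn.ne' (hx n)
  simpa using hfalse

lemma ae_returnDrift_lt_top [IsMarkovKernel P] [IsProbabilityMeasure π]
    (hinv : π.bind P = π) {φ : Measure X} (hφ : φ ≠ 0)
    (hirr : ∀ A : Set X, MeasurableSet A → 0 < φ A → ∀ x : X, ∃ n : ℕ, 1 ≤ n ∧ 0 < iterK P n x A)
    (hB : MeasurableSet B) (hπB : 0 < π B) : ∀ᵐ x ∂π, returnDrift P B x < ⊤ := by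
  set g := B.indicator (meanReturn P B)
  have hg : Measurable g := (measurable_meanReturn hB).indicator hB
  have hV : Measurable (returnDrift P B) := measurable_returnDrift hB
  have hgle : ∫⁻ x, g x ∂π ≤ 1 := by
    rw [lintegral_indicator hB]
    exact setLIntegral_meanReturn_le_one hinv hB
  have hiter (n : ℕ) : ∫⁻ x, transIter P g n x ∂π = ∫⁻ x, g x ∂π := by
    induction n with
    | zero => rfl
    | succ n ih => rw [← ih]; exact lintegral_lintegral_of_invariant hinv (measurable_transIter hg n)
  have hmeas (n : ℕ) : Measurable fun x => (2⁻¹ : ℝ≥0∞) ^ n * transIter P g n x :=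
    (measurable_transIter hg n).const_mul _
  have hS : ∀ᵐ x ∂π, ∑' n, (2⁻¹ : ℝ≥0∞) ^ n * transIter P g n x < ⊤ := by
    refine ae_lt_top (Measurable.tsum hmeas) (ne_top_of_le_ne_top (b := 2) (by simp) ?_)
    rw [lintegral_tsum fun n => (hmeas n).aemeasurable]
    simp_rw [lintegral_const_mul _ (measurable_transIter hg _), hiter, ENNReal.tsum_mul_right]
    rw [ENNReal.tsum_geometric, ENNReal.one_sub_inv_two, inv_inv]
    exact mul_le_of_le_one_right zero_le hgle
  have hh : ∀ᵐ x ∂π, g x < ⊤ := ae_lt_top hg (ne_top_of_le_ne_top (by simp) hgle)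
  have hG : MeasurableSet {x | returnDrift P B x < ⊤} := measurableSet_lt hV measurable_const
  refine measure_compl_eq_zero_of_absorbing hinv hφ hirr hG ?_ fun n x hx => ?_
  · by_contra hemp
    refine hπB.ne' (measure_mono_null (fun x hx => ?_) (hS.and hh))
    rintro ⟨h1, h2⟩
    refine hemp ⟨x, ENNReal.add_lt_top.2 ⟨?_, h1⟩⟩
    simpa only [g, indicator_of_mem hx] using h2
  · refine ae_lt_top hV (ne_top_of_le_ne_top ?_
      (lintegral_iterK_le hV (lintegral_returnDrift_le hB) n x))
    exact ENNReal.mul_ne_top (by simp) (ne_of_lt hx)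

section Realization

variable {Ω : Type*} [MeasurableSpace Ω] {μ : Measure Ω} {Y : ℕ → Ω → X} {ν : Measure X}

lemma IsMarkovReal.setLIntegral_succ (hY : IsMarkovReal P ν μ Y) {n : ℕ} {E : Set Ω}
    (hE : MeasurableSet[MeasurableSpace.comap (fun ω (i : Fin (n + 1)) => Y i ω) inferInstance] E)
    {f : X → ℝ≥0∞} (hf : Measurable f) :
    ∫⁻ ω in E, f (Y (n + 1) ω) ∂μ = ∫⁻ ω in E, ∫⁻ y, f y ∂P (Y n ω) ∂μ := by
  obtain ⟨hm, -, hstep⟩ := hY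
  have hmap : (μ.restrict E).map (Y (n + 1)) = ((μ.restrict E).map (Y n)).bind P := by
    ext A hA
    rw [Measure.map_apply (hm _) hA, Measure.restrict_apply (hm _ hA),
      Measure.bind_apply hA P.measurable.aemeasurable,
      lintegral_map (P.measurable_coe hA) (hm n), ← hstep n A hA E hE, inter_comm]
    rfl
  rw [← lintegral_map hf (hm _), hmap,
    Measure.lintegral_bind P.measurable.aemeasurable hf.aemeasurable,
    lintegral_map hf.lintegral_kernel (hm n)]

lemma IsMarkovReal.measure_avoid (hY : IsMarkovReal P ν μ Y) (hB : MeasurableSet B) (n : ℕ) :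
    μ {ω | ∀ k, 1 ≤ k → k ≤ n → Y k ω ∉ B} = ∫⁻ x, avoidProb P B n x ∂ν := by
  have key (n m : ℕ) : ∫⁻ ω in {ω | ∀ k, 1 ≤ k → k ≤ m → Y k ω ∉ B}, avoidProb P B n (Y m ω) ∂μ
      = ∫⁻ x, avoidProb P B (n + m) x ∂ν := by
    induction m generalizing n with
    | zero =>
      have huniv : {ω | ∀ k, 1 ≤ k → k ≤ 0 → Y k ω ∉ B} = univ :=
        eq_univ_of_forall fun ω k h1 h2 => absurd h1 (by omega)
      rw [huniv, setLIntegral_univ, ← hY.2.1, lintegral_map (measurable_avoidProb hB _) (hY.1 0)]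
      rfl
    | succ m ih =>
      have hE : MeasurableSet[MeasurableSpace.comap (fun ω (i : Fin (m + 1)) => Y i ω)
          inferInstance] {ω | ∀ k, 1 ≤ k → k ≤ m → Y k ω ∉ B} := by
        refine ⟨{f | ∀ i : Fin (m + 1), 1 ≤ (i : ℕ) → f i ∉ B}, ?_, ?_⟩
        · simp only [ofPred_forall]
          exact MeasurableSet.iInter fun i => MeasurableSet.iInter fun _ =>
            (measurable_pi_apply i : Measurable fun f : Fin (m + 1) → X => f i) hB.compl
        · ext ω
          exact ⟨fun h k h1 h2 => h ⟨k, by omega⟩ h1, fun h i h1 => h i h1 (by omega)⟩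
      have hsplit : {ω | ∀ k, 1 ≤ k → k ≤ m + 1 → Y k ω ∉ B}
          = (Y (m + 1) ⁻¹' Bᶜ) ∩ {ω | ∀ k, 1 ≤ k → k ≤ m → Y k ω ∉ B} := by
        ext ω
        refine ⟨fun h => ⟨h _ (by omega) le_rfl, fun k h1 h2 => h k h1 (by omega)⟩, ?_⟩
        rintro ⟨h, h'⟩ k h1 h2
        rcases h2.lt_or_eq with h2 | rfl
        · exact h' k h1 (by omega)
        · exact h
      rw [hsplit, ← Measure.restrict_restrict (hY.1 _ hB.compl),
        ← lintegral_indicator (hY.1 _ hB.compl)]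
      have := hY.setLIntegral_succ hE ((measurable_avoidProb (P := P) hB n).indicator hB.compl)
      simp only [lintegral_indicator hB.compl] at this
      refine (Eq.trans ?_ this).trans ((ih (n + 1)).trans (by rw [Nat.add_right_comm, add_assoc]))
      rfl
  simpa [avoidProb] using key 0 n

omit [MeasurableSpace X] [MeasurableSpace Ω] in
lemma hitTime_le_tsum (B : Set X) (ω : Ω) :
    hitTime Y B ω ≤ ∑' n, {ω | ∀ k, 1 ≤ k → k ≤ n → Y k ω ∉ B}.indicator 1 ω := by
  classical
  by_cases h : ∃ n, 1 ≤ n ∧ Y n ω ∈ B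
  · refine (iInf₂_le (Nat.find h) (Nat.find_spec h)).trans ?_
    refine le_trans ?_ (ENNReal.sum_le_tsum (Finset.range (Nat.find h)))
    rw [Finset.sum_congr rfl (g := fun _ => 1) fun n hn => ?_]
    · simp
    · refine indicator_of_mem (fun k h1 h2 hk => ?_) _
      exact Nat.find_min h (h2.trans_lt (Finset.mem_range.1 hn)) ⟨h1, hk⟩
  · push Not at h
    have hmem (n : ℕ) : ω ∈ {ω | ∀ k, 1 ≤ k → k ≤ n → Y k ω ∉ B} := fun k h1 _ => h k h1
    rw [tsum_congr (g := fun _ => 1) fun n => indicator_of_mem (hmem n) _]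
    simp

lemma IsMarkovReal.lintegral_hitTime_le (hY : IsMarkovReal P ν μ Y) (hB : MeasurableSet B) :
    ∫⁻ ω, hitTime Y B ω ∂μ ≤ ∫⁻ x, meanReturn P B x ∂ν := by
  have hS (n : ℕ) : MeasurableSet {ω | ∀ k, 1 ≤ k → k ≤ n → Y k ω ∉ B} := by
    simp only [ofPred_forall]
    exact MeasurableSet.iInter fun k => MeasurableSet.iInter fun _ => MeasurableSet.iInter fun _ =>
      hY.1 k hB.compl
  refine (lintegral_mono (hitTime_le_tsum B)).trans_eq ?_
  unfold meanReturn
  rw [lintegral_tsum fun n => (measurable_one.indicator (hS n)).aemeasurable,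
    lintegral_tsum fun n => (measurable_avoidProb hB n).aemeasurable]
  exact tsum_congr fun n => by rw [lintegral_indicator_one (hS n), hY.measure_avoid hB]

end Realization

end Helpers

/-- Corollary 14 (Aimply): (A3) with ν* = μ* implies (A2): if P is φ-irreducible with
stationary probability π, π(K_D) > 0 and π(K_{2D}∖K_D) > 0, and K_{2D}∖K_D is small
for P with minorizing measure μ* (the measure concentrated on K_{2D}∖K_D from (A1)),
then a Markov chain with transitions P started from μ* reaches K_D in finite expected
time. -/
theorem A2_of_A3_with_nu_eq_mu
    {𝒳 : Type*} [MeasurableSpace 𝒳] [MetricSpace 𝒳] [BorelSpace 𝒳]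
    (P : Kernel 𝒳 𝒳) [IsMarkovKernel P] (π : Measure 𝒳) [IsProbabilityMeasure π]
    -- π is stationary for P
    (hstat : ∀ A : Set 𝒳, MeasurableSet A → ∫⁻ x, P x A ∂π = π A)
    -- P is φ-irreducible
    (φ : Measure 𝒳) [SigmaFinite φ] (hφ : φ ≠ 0)
    (hirr : ∀ A : Set 𝒳, MeasurableSet A → 0 < φ A → ∀ x : 𝒳,
        ∃ n : ℕ, 1 ≤ n ∧ 0 < iterK P n x A)
    (D : ℝ) (hD : 0 < D) (hjump : ∀ x, P x {y | dist x y ≤ D} = 1)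
    (K : Set 𝒳) (hKmeas : MeasurableSet K) (hKne : K.Nonempty)
    (hKbdd : Bornology.IsBounded K)
    (hπKD : 0 < π (cthickening D K))
    (hπO : 0 < π (cthickening (2 * D) K \ cthickening D K))
    -- μ* is a probability measure concentrated on K_{2D} ∖ K_D, as in (A1)
    (μstar : Measure 𝒳) [IsProbabilityMeasure μstar]
    (hconc : μstar (cthickening (2 * D) K \ cthickening D K) = 1)
    -- (A3) with ν* = μ*
    (ε : ℝ≥0∞) (hε : 0 < ε) (n₀ : ℕ) (hn₀ : 1 ≤ n₀)
    (hA3 : ∀ x ∈ cthickening (2 * D) K \ cthickening D K, ∀ A : Set 𝒳, MeasurableSet A →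
        ε * μstar A ≤ iterK P n₀ x A) :
    -- (A2): any Markov chain realization with transitions P started from μ*
    -- has finite expected hitting time of K_D
    ∀ (Ω : Type) [MeasurableSpace Ω] (μ : Measure Ω) (Y : ℕ → Ω → 𝒳),
      IsProbabilityMeasure μ → IsMarkovReal P μstar μ Y →
      ∫⁻ ω, hitTime Y (cthickening D K) ω ∂μ < ⊤ := by
  intro Ω _ μ Y _ hY
  have hB : MeasurableSet (cthickening D K) := isClosed_cthickening.measurableSet
  have hinv : π.bind P = π := by
    ext A hA
    rw [Measure.bind_apply hA P.measurable.aemeasurable, hstat A hA]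
  have hV := measurable_returnDrift (P := P) hB
  obtain ⟨y, hyO, hy⟩ : ∃ y ∈ cthickening (2 * D) K \ cthickening D K,
      returnDrift P (cthickening D K) y < ⊤ := by
    by_contra! h
    refine hπO.ne' (measure_mono_null (fun x hx => ?_)
      (ae_returnDrift_lt_top hinv hφ hirr hB hπKD))
    exact not_lt.2 (h x hx)
  have hle : ε • μstar ≤ iterK P n₀ y := Measure.le_iff.2 fun A hA => hA3 y hyO A hA
  have hfin : ε * ∫⁻ x, returnDrift P (cthickening D K) x ∂μstar < ⊤ := by
    rw [← smul_eq_mul, ← lintegral_smul_measure]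
    refine (lintegral_mono' hle le_rfl).trans_lt ((lintegral_iterK_le hV
      (lintegral_returnDrift_le hB) n₀ y).trans_lt (ENNReal.mul_lt_top (by simp) hy))
  refine (hY.lintegral_hitTime_le hB).trans_lt ((lintegral_mono fun x => ?_).trans_lt
    (ENNReal.lt_top_of_mul_ne_top_right hfin.ne hε.ne'))
  exact le_self_add
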